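/- Let ρ and ρ' be density matrices of the same finite dimension n with different spectra. Suppose there exists a finite-dimensional quasi-classical density matrix σ (diagonal in a fixed orthonormal basis {|j⟩}) and a unitary U on the joint space such that tr₂[U(ρ ⊗ σ)U†] = ρ' and D[tr₁[U(ρ ⊗ σ)U†]] = σ, where D is the dephasing channel in the basis {|j⟩}. Then S(ρ') > S(ρ) and rank(ρ') ≥ rank(ρ). -/

import Mathlib

open scoped Kronecker ComplexOrder
open Matrix

noncomputable section

/-- `ρ` is a density matrix: positive semidefinite with unit trace. -/
def IsDensityMatrix {ι : Type*} [Fintype ι] (ρ : Matrix ι ι ℂ) : Prop :=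
  ρ.PosSemidef ∧ ρ.trace = 1

/-- Partial trace over the second tensor factor. -/
def ptrace2 {ι κ : Type*} [Fintype κ] (M : Matrix (ι × κ) (ι × κ) ℂ) : Matrix ι ι ℂ :=
  Matrix.of fun i j => ∑ k, M (i, k) (j, k)

/-- Partial trace over the first tensor factor. -/
def ptrace1 {ι κ : Type*} [Fintype ι] (M : Matrix (ι × κ) (ι × κ) ℂ) : Matrix κ κ ℂ :=
  Matrix.of fun i j => ∑ k, M (k, i) (k, j)

/-- Dephasing (decoherence) channel in the fixed (standard) orthonormal basis `{|j⟩}`: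
`D[σ] = ∑ j ⟨j|σ|j⟩ |j⟩⟨j|`. -/
def deph {ι : Type*} [DecidableEq ι] (M : Matrix ι ι ℂ) : Matrix ι ι ℂ :=
  Matrix.diagonal fun j => M j j

/-- The eigenvalue list of a matrix (junk value `0` if not Hermitian). -/
def eigs {ι : Type*} [Fintype ι] [DecidableEq ι] (ρ : Matrix ι ι ℂ) : ι → ℝ :=
  if h : ρ.IsHermitian then h.eigenvalues else 0

/-- The spectrum of a matrix, as a multiset of real eigenvalues (with multiplicity). -/
def spectra {ι : Type*} [Fintype ι] [DecidableEq ι] (ρ : Matrix ι ι ℂ) : Multiset ℝ :=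
  Finset.univ.val.map (eigs ρ)

/-- von Neumann entropy `S(ρ) = -tr(ρ log ρ)`, i.e. the Shannon entropy
of the eigenvalue list (natural logarithm). -/
def vN {ι : Type*} [Fintype ι] [DecidableEq ι] (ρ : Matrix ι ι ℂ) : ℝ :=
  ∑ i, Real.negMulLog (eigs ρ i)

/-- Maximally mixed state `𝟙_d = (1/d)·I_d`. -/
def mm (d : ℕ) : Matrix (Fin d) (Fin d) ℂ :=
  (d : ℂ)⁻¹ • (1 : Matrix (Fin d) (Fin d) ℂ)

/-- A family of reals is determined up to reordering by its power sums. -/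
theorem multiset_map_eq_of_sum_pow_eq {ι κ : Type*} [Fintype ι] [Fintype κ]
    (r : ι → ℝ) (p : κ → ℝ) (h : ∀ k : ℕ, ∑ i, r i ^ k = ∑ i, p i ^ k) :
    Finset.univ.val.map r = Finset.univ.val.map p := by
  classical
  have heval (f : Polynomial ℝ) : ∑ i, f.eval (r i) = ∑ i, f.eval (p i) := by
    simp only [Polynomial.eval_eq_sum_range]
    rw [Finset.sum_comm, Finset.sum_comm (s := (Finset.univ : Finset κ))]
    simp only [← Finset.mul_sum, h]
  ext c
  let s : Finset ℝ := insert c (Finset.univ.image r ∪ Finset.univ.image p)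
  have hbasis (x : ℝ) (hx : x ∈ s) :
      (Lagrange.basis s id c).eval x = if c = x then 1 else 0 := by
    split_ifs with hc
    · subst hc
      exact Lagrange.eval_basis_self (Function.injective_id.injOn) hx
    · exact Lagrange.eval_basis_of_ne (v := id) hc hx
  have hcount := heval (Lagrange.basis s id c)
  rw [Finset.sum_congr rfl fun i _ => hbasis (r i) (by simp [s]),
    Finset.sum_congr rfl fun i _ => hbasis (p i) (by simp [s])] at hcount
  simp only [Finset.sum_boole, Nat.cast_inj] at hcount
  simpa only [Multiset.count_map, Finset.card_def, Finset.filter_val] using hcount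

theorem klein_gap_nonneg {a b : ℝ} (ha : 0 ≤ a) (hb : 0 ≤ b) (h : b = 0 → a = 0) :
    0 ≤ b - a + a * (Real.log a - Real.log b) ∧
      (b - a + a * (Real.log a - Real.log b) = 0 → a = b) := by
  rcases ha.eq_or_lt with rfl | ha
  · simpa [eq_comm] using hb
  have hb : 0 < b := hb.lt_of_ne fun h0 => ha.ne' (h h0.symm)
  by_cases hab : a = b
  · subst hab
    simp
  have hlog := Real.log_lt_sub_one_of_pos (div_pos hb ha) (by
    rw [Ne, div_eq_one_iff_eq ha.ne']
    exact fun h => hab h.symm)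
  rw [Real.log_div hb.ne' ha.ne'] at hlog
  have hmul := mul_lt_mul_of_pos_left hlog ha
  have hcancel : a * (b / a - 1) = b - a := by field_simp
  have hpos : 0 < b - a + a * (Real.log a - Real.log b) := by linarith
  exact ⟨hpos.le, fun h => absurd h hpos.ne'⟩

section DoublyStochastic

variable {α β : Type*} [Fintype α] [Fintype β]

/-- Klein's inequality for a doubly stochastic kernel, with its equality case. -/
theorem klein_inequality {B : α → β → ℝ} (hB : ∀ x y, 0 ≤ B x y)
    (hrow : ∀ x, ∑ y, B x y = 1) (hcol : ∀ y, ∑ x, B x y = 1)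
    {a : β → ℝ} {b : α → ℝ} (ha : ∀ y, 0 ≤ a y) (hb : ∀ x, 0 ≤ b x)
    (hsum : ∑ y, a y = ∑ x, b x) (hsupp : ∀ x y, B x y ≠ 0 → b x = 0 → a y = 0) :
    ∑ y, Real.negMulLog (a y) ≤ -∑ x, (∑ y, B x y * a y) * Real.log (b x) ∧
      (∑ y, Real.negMulLog (a y) = -∑ x, (∑ y, B x y * a y) * Real.log (b x) →
        ∀ x y, B x y ≠ 0 → a y = b x) := by
  have hgap (x : α) (y : β) (h0 : B x y ≠ 0) :=
    klein_gap_nonneg (ha y) (hb x) (hsupp x y h0)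
  have hterm (x : α) (y : β) :
      0 ≤ B x y * (b x - a y + a y * (Real.log (a y) - Real.log (b x))) := by
    by_cases h0 : B x y = 0
    · simp [h0]
    · exact mul_nonneg (hB x y) (hgap x y h0).1
  have hright (f : β → ℝ) : ∑ x, ∑ y, B x y * f y = ∑ y, f y := by
    rw [Finset.sum_comm]
    simp [← Finset.sum_mul, hcol]
  have hleft (f : α → ℝ) : ∑ x, ∑ y, B x y * f x = ∑ x, f x := by
    simp [← Finset.sum_mul, hrow]
  have htotal : ∑ x, ∑ y, B x y * (b x - a y + a y * (Real.log (a y) - Real.log (b x))) =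
      -∑ x, (∑ y, B x y * a y) * Real.log (b x) - ∑ y, Real.negMulLog (a y) := by
    have hsplit (x : α) (y : β) :
        B x y * (b x - a y + a y * (Real.log (a y) - Real.log (b x))) =
          B x y * b x - B x y * a y - B x y * Real.negMulLog (a y)
            - B x y * a y * Real.log (b x) := by
      rw [Real.negMulLog]
      ring
    simp only [hsplit, Finset.sum_sub_distrib, hleft b, hright, Finset.sum_mul]
    rw [hsum]
    ring
  refine ⟨?_, fun heq x y h0 => ?_⟩
  · have := Finset.sum_nonneg fun x (_ : x ∈ Finset.univ) =>
      Finset.sum_nonneg fun y (_ : y ∈ Finset.univ) => hterm x y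
    linarith
  · rw [heq, sub_self, Finset.sum_eq_zero_iff_of_nonneg fun x _ =>
      Finset.sum_nonneg fun y _ => hterm x y] at htotal
    have hx := htotal x (Finset.mem_univ x)
    rw [Finset.sum_eq_zero_iff_of_nonneg fun y _ => hterm x y] at hx
    exact (hgap x y h0).2 ((mul_eq_zero.mp (hx y (Finset.mem_univ y))).resolve_left h0)

theorem sum_comp_eq_of_doublyStochastic {B : α → β → ℝ}
    (hrow : ∀ x, ∑ y, B x y = 1) (hcol : ∀ y, ∑ x, B x y = 1)
    {a : β → ℝ} {b : α → ℝ} (h : ∀ x y, B x y ≠ 0 → a y = b x) (f : ℝ → ℝ) :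
    ∑ y, f (a y) = ∑ x, f (b x) := by
  calc ∑ y, f (a y) = ∑ y, ∑ x, B x y * f (a y) := by simp [← Finset.sum_mul, hcol]
    _ = ∑ x, ∑ y, B x y * f (a y) := Finset.sum_comm
    _ = ∑ x, ∑ y, B x y * f (b x) := by
        refine Finset.sum_congr rfl fun x _ => Finset.sum_congr rfl fun y _ => ?_
        by_cases h0 : B x y = 0
        · simp [h0]
        · rw [h x y h0]
    _ = ∑ x, f (b x) := by simp [← Finset.sum_mul, hrow]

theorem card_support_le_of_doublyStochastic {B : α → β → ℝ} (hB : ∀ x y, 0 ≤ B x y)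
    (hrow : ∀ x, ∑ y, B x y = 1) (hcol : ∀ y, ∑ x, B x y = 1)
    {a : β → ℝ} {b : α → ℝ} (hsupp : ∀ x y, B x y ≠ 0 → b x = 0 → a y = 0) :
    Nat.card {y // a y ≠ 0} ≤ Nat.card {x // b x ≠ 0} := by
  classical
  rw [← Nat.cast_le (α := ℝ)]
  simp only [Nat.card_eq_fintype_card, Fintype.card_subtype, ← Finset.sum_boole]
  calc ∑ y, (if a y ≠ 0 then (1 : ℝ) else 0)
      = ∑ y, ∑ x, B x y * (if a y ≠ 0 then (1 : ℝ) else 0) := by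
        simp [hcol]
    _ = ∑ x, ∑ y, B x y * (if a y ≠ 0 then (1 : ℝ) else 0) := Finset.sum_comm
    _ ≤ ∑ x, ∑ y, B x y * (if b x ≠ 0 then (1 : ℝ) else 0) := by
        refine Finset.sum_le_sum fun x _ => Finset.sum_le_sum fun y _ => ?_
        by_cases h0 : B x y = 0
        · simp [h0]
        · have := hsupp x y h0
          refine mul_le_mul_of_nonneg_left ?_ (hB x y)
          by_cases hb : b x = 0
          · simp [hb, this hb]
          · by_cases ha : a y = 0 <;> simp [hb, ha]
    _ = ∑ x, (if b x ≠ 0 then (1 : ℝ) else 0) := by simp [hrow]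

end DoublyStochastic

theorem card_support_mul {ι κ : Type*} [Finite ι] [Finite κ] (r : ι → ℝ) (q : κ → ℝ) :
    Nat.card {y : ι × κ // r y.1 * q y.2 ≠ 0} =
      Nat.card {i // r i ≠ 0} * Nat.card {j // q j ≠ 0} := by
  rw [← Nat.card_prod]
  refine Nat.card_congr ((Equiv.subtypeEquivRight fun y => ?_).trans Equiv.subtypeProdEquivProd)
  exact mul_ne_zero_iff

theorem sum_negMulLog_mul {ι κ : Type*} [Fintype ι] [Fintype κ] {r : ι → ℝ} {q : κ → ℝ}
    (hr : ∑ i, r i = 1) (hq : ∑ j, q j = 1) :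
    ∑ y : ι × κ, Real.negMulLog (r y.1 * q y.2) =
      ∑ i, Real.negMulLog (r i) + ∑ j, Real.negMulLog (q j) := by
  simp [Fintype.sum_prod_type, Real.negMulLog_mul, Finset.sum_add_distrib, ← Finset.mul_sum,
    ← Finset.sum_mul, hr, hq]

/-- The classical core: if a doubly stochastic matrix sends the product distribution `r ⊗ q` to
a joint distribution with marginals `p` and `q`, and `r`, `p` are not permutations of each other,
then the entropy strictly increases from `r` to `p` and the support does not shrink. -/
theorem entropy_lt_and_card_support_le {ι κ : Type*} [Fintype ι] [Fintype κ]
    {B : ι × κ → ι × κ → ℝ} (hB : ∀ x y, 0 ≤ B x y)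
    (hrow : ∀ x, ∑ y, B x y = 1) (hcol : ∀ y, ∑ x, B x y = 1)
    {r p : ι → ℝ} {q : κ → ℝ} (hr : ∀ i, 0 ≤ r i) (hp : ∀ i, 0 ≤ p i) (hq : ∀ j, 0 ≤ q j)
    (hr1 : ∑ i, r i = 1) (hp1 : ∑ i, p i = 1) (hq1 : ∑ j, q j = 1)
    (hmarg₁ : ∀ i, ∑ j, ∑ y, B (i, j) y * (r y.1 * q y.2) = p i)
    (hmarg₂ : ∀ j, ∑ i, ∑ y, B (i, j) y * (r y.1 * q y.2) = q j)
    (hne : Finset.univ.val.map r ≠ Finset.univ.val.map p) :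
    ∑ i, Real.negMulLog (r i) < ∑ i, Real.negMulLog (p i) ∧
      Nat.card {i // r i ≠ 0} ≤ Nat.card {i // p i ≠ 0} := by
  set a : ι × κ → ℝ := fun y => r y.1 * q y.2 with ha_def
  set b : ι × κ → ℝ := fun x => p x.1 * q x.2 with hb_def
  set P : ι × κ → ℝ := fun x => ∑ y, B x y * a y with hP_def
  have ha (y) : 0 ≤ a y := mul_nonneg (hr _) (hq _)
  have hb (x) : 0 ≤ b x := mul_nonneg (hp _) (hq _)
  have hterm (x y) : 0 ≤ B x y * a y := mul_nonneg (hB x y) (ha y)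
  have hP (x) : 0 ≤ P x := Finset.sum_nonneg fun y _ => hterm x y
  have hPp (x) : P x ≤ p x.1 := by
    rw [← hmarg₁]
    exact Finset.single_le_sum (f := fun j => P (x.1, j)) (fun j _ => hP _) (Finset.mem_univ x.2)
  have hPq (x) : P x ≤ q x.2 := by
    rw [← hmarg₂]
    exact Finset.single_le_sum (f := fun i => P (i, x.2)) (fun i _ => hP _) (Finset.mem_univ x.1)
  have hPb (x) (hx : b x = 0) : P x = 0 := by
    rcases mul_eq_zero.mp hx with h | h
    · exact le_antisymm (h ▸ hPp x) (hP x)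
    · exact le_antisymm (h ▸ hPq x) (hP x)
  have hsupp (x y) (h0 : B x y ≠ 0) (hx : b x = 0) : a y = 0 := by
    have hzero := hPb x hx
    rw [hP_def, Finset.sum_eq_zero_iff_of_nonneg fun y _ => hterm x y] at hzero
    exact (mul_eq_zero.mp (hzero y (Finset.mem_univ y))).resolve_left h0
  have hP₁ (i) : ∑ j, P (i, j) = p i := hmarg₁ i
  have hP₂ (j) : ∑ i, P (i, j) = q j := hmarg₂ j
  have hlog (x) : P x * Real.log (b x) = P x * Real.log (p x.1) + P x * Real.log (q x.2) := by
    by_cases hx : b x = 0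
    · simp [hPb x hx]
    · rw [hb_def, Real.log_mul (left_ne_zero_of_mul hx) (right_ne_zero_of_mul hx), mul_add]
  have hcross : -∑ x, P x * Real.log (b x) =
      ∑ i, Real.negMulLog (p i) + ∑ j, Real.negMulLog (q j) := by
    simp only [hlog, Finset.sum_add_distrib]
    rw [Fintype.sum_prod_type, Fintype.sum_prod_type_right]
    simp only [← Finset.sum_mul, hP₁, hP₂, Real.negMulLog, neg_mul,
      Finset.sum_neg_distrib]
    ring
  have hsum_a : ∑ y, a y = 1 := by
    simp [ha_def, Fintype.sum_prod_type, ← Finset.mul_sum, hr1, hq1]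
  have hsum_b : ∑ x, b x = 1 := by
    simp [hb_def, Fintype.sum_prod_type, ← Finset.mul_sum, hp1, hq1]
  obtain ⟨hle, heq⟩ := klein_inequality hB hrow hcol ha hb (hsum_a.trans hsum_b.symm) hsupp
  rw [hcross, sum_negMulLog_mul hr1 hq1] at hle heq
  obtain ⟨j₀, -, hj₀⟩ : ∃ j ∈ Finset.univ, q j ≠ 0 :=
    Finset.exists_ne_zero_of_sum_ne_zero (by rw [hq1]; exact one_ne_zero)
  refine ⟨lt_of_le_of_ne (by linarith) fun h => hne ?_, ?_⟩
  · have hsame := heq (by rw [h])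
    refine multiset_map_eq_of_sum_pow_eq r p fun k => ?_
    have hpow := sum_comp_eq_of_doublyStochastic hrow hcol hsame (· ^ k)
    simp only [ha_def, hb_def, mul_pow, Fintype.sum_prod_type, ← Finset.mul_sum,
      ← Finset.sum_mul] at hpow
    refine mul_right_cancel₀ (ne_of_gt ?_) hpow
    exact Finset.sum_pos' (fun j _ => pow_nonneg (hq j) k)
      ⟨j₀, Finset.mem_univ _, pow_pos ((hq j₀).lt_of_ne' hj₀) k⟩
  · have hcard := card_support_le_of_doublyStochastic hB hrow hcol hsupp
    rw [card_support_mul, card_support_mul] at hcard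
    have : Nonempty {j // q j ≠ 0} := ⟨⟨j₀, hj₀⟩⟩
    exact Nat.le_of_mul_le_mul_right hcard Nat.card_pos

section Unitary

variable {ι : Type*} [Fintype ι] [DecidableEq ι]

theorem sum_normSq_row_of_mem_unitaryGroup {W : Matrix ι ι ℂ}
    (hW : W ∈ Matrix.unitaryGroup ι ℂ) (x : ι) : ∑ y, Complex.normSq (W x y) = 1 := by
  have h := congrFun (congrFun (Matrix.mem_unitaryGroup_iff.mp hW) x) x
  simp only [Matrix.mul_apply, Matrix.star_apply, Complex.star_def, Complex.mul_conj,
    Matrix.one_apply_eq] at h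
  exact_mod_cast h

theorem sum_normSq_col_of_mem_unitaryGroup {W : Matrix ι ι ℂ}
    (hW : W ∈ Matrix.unitaryGroup ι ℂ) (y : ι) : ∑ x, Complex.normSq (W x y) = 1 := by
  simpa using sum_normSq_row_of_mem_unitaryGroup (Unitary.star_mem hW) y

theorem mul_diagonal_mul_conjTranspose_apply_self (W : Matrix ι ι ℂ) (d : ι → ℝ) (x : ι) :
    (W * Matrix.diagonal (fun y => (d y : ℂ)) * Wᴴ) x x =
      ((∑ y, Complex.normSq (W x y) * d y : ℝ) : ℂ) := by
  rw [Matrix.mul_apply]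
  simp only [Matrix.mul_diagonal, Matrix.conjTranspose_apply, Complex.star_def]
  push_cast
  refine Finset.sum_congr rfl fun y _ => ?_
  rw [← Complex.mul_conj]
  ring

theorem IsDensityMatrix.eigs_eq {ρ : Matrix ι ι ℂ} (hρ : IsDensityMatrix ρ) :
    eigs ρ = hρ.1.isHermitian.eigenvalues :=
  dif_pos hρ.1.isHermitian

theorem IsDensityMatrix.eigs_nonneg {ρ : Matrix ι ι ℂ} (hρ : IsDensityMatrix ρ) (i : ι) :
    0 ≤ eigs ρ i := by
  rw [hρ.eigs_eq]
  exact hρ.1.eigenvalues_nonneg i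

theorem IsDensityMatrix.sum_eigs {ρ : Matrix ι ι ℂ} (hρ : IsDensityMatrix ρ) :
    ∑ i, eigs ρ i = 1 := by
  have h := hρ.2.symm.trans hρ.1.isHermitian.trace_eq_sum_eigenvalues
  rw [hρ.eigs_eq]
  apply Complex.ofReal_injective
  push_cast
  exact h.symm

theorem IsDensityMatrix.rank_eq {ρ : Matrix ι ι ℂ} (hρ : IsDensityMatrix ρ) :
    ρ.rank = Nat.card {i // eigs ρ i ≠ 0} := by
  rw [hρ.1.isHermitian.rank_eq_card_non_zero_eigs, hρ.eigs_eq, Nat.card_eq_fintype_card]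

theorem IsDensityMatrix.exists_diagonalization {ρ : Matrix ι ι ℂ} (hρ : IsDensityMatrix ρ) :
    ∃ V ∈ Matrix.unitaryGroup ι ℂ, ρ = V * Matrix.diagonal (fun i => (eigs ρ i : ℂ)) * Vᴴ := by
  refine ⟨hρ.1.isHermitian.eigenvectorUnitary, SetLike.coe_mem _, ?_⟩
  have h := hρ.1.isHermitian.spectral_theorem
  rw [Unitary.conjStarAlgAut_apply] at h
  rw [hρ.eigs_eq]
  exact h

end Unitary

section PartialTrace

variable {ι κ : Type*} [Fintype ι] [Fintype κ] [DecidableEq κ]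

theorem ptrace2_kronecker_one_conj (A C : Matrix ι ι ℂ)
    (M : Matrix (ι × κ) (ι × κ) ℂ) :
    ptrace2 ((A ⊗ₖ (1 : Matrix κ κ ℂ)) * M * (C ⊗ₖ (1 : Matrix κ κ ℂ))) = A * ptrace2 M * C := by
  ext i j
  simp only [ptrace2, Matrix.of_apply, Matrix.mul_apply, Fintype.sum_prod_type,
    Matrix.kroneckerMap_apply, Matrix.one_apply, mul_ite, ite_mul, mul_one, mul_zero, zero_mul,
    Finset.sum_ite_eq, Finset.sum_ite_eq', Finset.mem_univ, if_true, Finset.sum_mul,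
    Finset.mul_sum]
  rw [Finset.sum_comm]
  refine Finset.sum_congr rfl fun k _ => ?_
  rw [Finset.sum_comm]

theorem ptrace1_kronecker_one_conj [DecidableEq ι] {A C : Matrix ι ι ℂ}
    (hCA : C * A = 1) (M : Matrix (ι × κ) (ι × κ) ℂ) :
    ptrace1 ((A ⊗ₖ (1 : Matrix κ κ ℂ)) * M * (C ⊗ₖ (1 : Matrix κ κ ℂ))) = ptrace1 M := by
  ext i j
  simp only [ptrace1, Matrix.of_apply, Matrix.mul_apply, Fintype.sum_prod_type,
    Matrix.kroneckerMap_apply, Matrix.one_apply, mul_ite, ite_mul, mul_one, mul_zero, zero_mul,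
    Finset.sum_ite_eq, Finset.sum_ite_eq', Finset.mem_univ, if_true, Finset.sum_mul]
  have hentry (k l : ι) : ∑ x, A x l * C k x = if k = l then 1 else 0 := by
    rw [← Matrix.one_apply, ← hCA, Matrix.mul_apply]
    exact Finset.sum_congr rfl fun x _ => mul_comm _ _
  calc ∑ x, ∑ k, ∑ l, A x l * M (l, i) (k, j) * C k x
      = ∑ k, ∑ l, M (l, i) (k, j) * ∑ x, A x l * C k x := by
        rw [Finset.sum_comm]
        refine Finset.sum_congr rfl fun k _ => ?_
        rw [Finset.sum_comm]
        refine Finset.sum_congr rfl fun l _ => ?_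
        rw [Finset.mul_sum]
        exact Finset.sum_congr rfl fun x _ => by ring
    _ = ∑ k, M (k, i) (k, j) := by simp [hentry]

end PartialTrace

/-- If density matrices `ρ, ρ'` with different spectra admit a transition
with a quasi-classical catalyst that is returned after dephasing, then `S(ρ') > S(ρ)` and
`rank ρ' ≥ rank ρ`. -/
theorem stmt1 {n : ℕ} (ρ ρ' : Matrix (Fin n) (Fin n) ℂ)
    (hρ : IsDensityMatrix ρ) (hρ' : IsDensityMatrix ρ')
    (hspec : spectra ρ ≠ spectra ρ')
    (h : ∃ (m : ℕ) (σ : Matrix (Fin m) (Fin m) ℂ),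
      IsDensityMatrix σ ∧ deph σ = σ ∧
      ∃ U ∈ Matrix.unitaryGroup (Fin n × Fin m) ℂ,
        ptrace2 (U * (ρ ⊗ₖ σ) * Uᴴ) = ρ' ∧
        deph (ptrace1 (U * (ρ ⊗ₖ σ) * Uᴴ)) = σ) :
    vN ρ < vN ρ' ∧ ρ.rank ≤ ρ'.rank := by
  obtain ⟨m, σ, hσ, hσd, U, hU, h2, h1⟩ := h
  obtain ⟨V, hV, hρV⟩ := hρ.exists_diagonalization
  obtain ⟨V', hV', hρV'⟩ := hρ'.exists_diagonalization
  have hV'V' : V'ᴴ * V' = 1 := Matrix.mem_unitaryGroup_iff'.mp hV'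
  have hV'V'_right : V' * V'ᴴ = 1 := Matrix.mem_unitaryGroup_iff.mp hV'
  let q : Fin m → ℝ := fun j => (σ j j).re
  have hqc (j) : ((q j : ℝ) : ℂ) = σ j j :=
    Complex.ext rfl (Complex.nonneg_iff.mp hσ.1.diag_nonneg).2
  have hσq : σ = Matrix.diagonal fun j => (q j : ℂ) := by
    rw [← hσd]
    simp only [deph, hqc]
  set W := (V'ᴴ ⊗ₖ (1 : Matrix (Fin m) (Fin m) ℂ)) * U * (V ⊗ₖ (1 : Matrix (Fin m) (Fin m) ℂ))
    with hW_def
  have hW : W ∈ Matrix.unitaryGroup (Fin n × Fin m) ℂ :=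
    mul_mem (mul_mem (Matrix.kronecker_mem_unitary (Unitary.star_mem hV') (one_mem _)) hU)
      (Matrix.kronecker_mem_unitary hV (one_mem _))
  have hconj : W * Matrix.diagonal (fun y => ((eigs ρ y.1 * q y.2 : ℝ) : ℂ)) * Wᴴ =
      (V'ᴴ ⊗ₖ (1 : Matrix (Fin m) (Fin m) ℂ)) * (U * (ρ ⊗ₖ σ) * Uᴴ) *
        (V' ⊗ₖ (1 : Matrix (Fin m) (Fin m) ℂ)) := by
    have hprod : ρ ⊗ₖ σ = (V ⊗ₖ (1 : Matrix (Fin m) (Fin m) ℂ)) *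
        Matrix.diagonal (fun y => ((eigs ρ y.1 * q y.2 : ℝ) : ℂ)) *
        (Vᴴ ⊗ₖ (1 : Matrix (Fin m) (Fin m) ℂ)) := by
      conv_lhs => rw [hρV, hσq]
      have hdiag : Matrix.diagonal (fun y : Fin n × Fin m => ((eigs ρ y.1 * q y.2 : ℝ) : ℂ)) =
          Matrix.diagonal (fun i => (eigs ρ i : ℂ)) ⊗ₖ Matrix.diagonal (fun j => (q j : ℂ)) := by
        rw [Matrix.diagonal_kronecker_diagonal]
        simp
      rw [hdiag, ← Matrix.mul_kronecker_mul, ← Matrix.mul_kronecker_mul]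
      simp
    rw [hprod, hW_def]
    simp only [Matrix.conjTranspose_mul, Matrix.conjTranspose_kronecker,
      Matrix.conjTranspose_conjTranspose, Matrix.conjTranspose_one, Matrix.mul_assoc]
  have hdiag (x) := mul_diagonal_mul_conjTranspose_apply_self W
    (fun y => eigs ρ y.1 * q y.2) x
  rw [hconj] at hdiag
  have hmarg₁ (i) : ∑ j, ∑ y, Complex.normSq (W (i, j) y) * (eigs ρ y.1 * q y.2) =
      eigs ρ' i := by
    have hptrace := ptrace2_kronecker_one_conj V'ᴴ V' (U * (ρ ⊗ₖ σ) * Uᴴ)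
    rw [h2] at hptrace
    have hentry := congrFun (congrFun hptrace i) i
    have hrot : V'ᴴ * ρ' * V' = Matrix.diagonal (fun i => (eigs ρ' i : ℂ)) := by
      conv_lhs => rw [hρV']
      rw [← Matrix.mul_assoc, ← Matrix.mul_assoc, hV'V', Matrix.one_mul, Matrix.mul_assoc, hV'V',
        Matrix.mul_one]
    rw [hrot, Matrix.diagonal_apply_eq] at hentry
    simp only [ptrace2, Matrix.of_apply, hdiag] at hentry
    exact_mod_cast hentry
  have hmarg₂ (j) : ∑ i, ∑ y, Complex.normSq (W (i, j) y) * (eigs ρ y.1 * q y.2) = q j := by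
    have hptrace := ptrace1_kronecker_one_conj hV'V'_right (U * (ρ ⊗ₖ σ) * Uᴴ)
    have hentry := congrFun (congrFun hptrace j) j
    have hσj := congrFun (congrFun h1 j) j
    rw [deph, Matrix.diagonal_apply_eq, ← hqc] at hσj
    rw [hσj] at hentry
    simp only [ptrace1, Matrix.of_apply, hdiag] at hentry
    exact_mod_cast hentry
  have hq1 : ∑ j, q j = 1 := by
    have htrace := hσ.2
    simp only [Matrix.trace, Matrix.diag_apply, ← hqc] at htrace
    exact_mod_cast htrace
  rw [hρ.rank_eq, hρ'.rank_eq]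
  exact entropy_lt_and_card_support_le (fun x y => Complex.normSq_nonneg (W x y))
    (sum_normSq_row_of_mem_unitaryGroup hW) (sum_normSq_col_of_mem_unitaryGroup hW)
    hρ.eigs_nonneg hρ'.eigs_nonneg (fun j => (Complex.nonneg_iff.mp hσ.1.diag_nonneg).1)
    hρ.sum_eigs hρ'.sum_eigs hq1 hmarg₁ hmarg₂ hspec
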